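/- Assume λ_ε ≥ ‖Xᵀε‖_∞/n, let 0 ≤ δ < 1, let λ > λ_ε, and set L := (λ + λ_ε + δ(λ−λ_ε)) / ((1−δ)(λ−λ_ε)). Then for every β ∈ ℝᵖ with active set S := S_β such that φ̂(L,S) > 0, the Lasso estimator β̂ satisfies 2δ(λ−λ_ε)‖β̂−β⁰‖₁ + ‖X(β̂−β⁰)‖_n² ≤ 2δ(λ−λ_ε)‖β−β⁰‖₁ + ‖X(β−β⁰)‖_n² + (λ + λ_ε + δ(λ−λ_ε))²·|S| / φ̂²(L,S). -/

import Mathlib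

open Finset Matrix

/-- `‖v‖_n = √(vᵀv/n)`. -/
noncomputable def normN {n : ℕ} (v : Fin n → ℝ) : ℝ :=
  Real.sqrt ((∑ i, v i ^ 2) / n)

/-- `ℓ₁`-norm of a vector. -/
noncomputable def l1norm {p : ℕ} (v : Fin p → ℝ) : ℝ := ∑ j, |v j|

/-- `ℓ_∞`-norm of a vector. -/
noncomputable def lsup {p : ℕ} (v : Fin p → ℝ) : ℝ := ⨆ j, |v j|

/-- `β_S`: the vector `β` with entries outside `S` set to zero. -/
def sub0 {p : ℕ} (S : Finset (Fin p)) (β : Fin p → ℝ) : Fin p → ℝ :=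
  fun j => if j ∈ S then β j else 0

/-- The compatibility constant squared `φ̂²(L,S)`. -/
noncomputable def compatSq {n p : ℕ} (X : Matrix (Fin n) (Fin p) ℝ) (L : ℝ)
    (S : Finset (Fin p)) : ℝ :=
  sInf { r | ∃ β : Fin p → ℝ, l1norm (sub0 S β) = 1 ∧ l1norm (sub0 Sᶜ β) ≤ L ∧
    r = S.card * (normN (X.mulVec (sub0 S β) - X.mulVec (sub0 Sᶜ β))) ^ 2 }

lemma normN_sq {n : ℕ} (v : Fin n → ℝ) : normN v ^ 2 = v ⬝ᵥ v / n := by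
  rw [normN, Real.sq_sqrt (by positivity)]
  simp [dotProduct, sq]

lemma normN_smul_sq {n : ℕ} (t : ℝ) (v : Fin n → ℝ) :
    normN (t • v) ^ 2 = t ^ 2 * normN v ^ 2 := by
  rw [normN_sq, normN_sq, smul_dotProduct, dotProduct_smul, smul_eq_mul, smul_eq_mul]
  ring

lemma normN_sub_sq {n : ℕ} (v w : Fin n → ℝ) :
    normN (v - w) ^ 2 = normN v ^ 2 - 2 * (v ⬝ᵥ w / n) + normN w ^ 2 := by
  rw [normN_sq, normN_sq, normN_sq, sub_dotProduct, dotProduct_sub, dotProduct_sub,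
    dotProduct_comm w v]
  ring

lemma l1norm_nonneg {p : ℕ} (v : Fin p → ℝ) : 0 ≤ l1norm v :=
  Finset.sum_nonneg fun _ _ => abs_nonneg _

lemma l1norm_smul {p : ℕ} (c : ℝ) (v : Fin p → ℝ) : l1norm (c • v) = |c| * l1norm v := by
  simp [l1norm, abs_mul, Finset.mul_sum]

lemma l1norm_add_le {p : ℕ} (v w : Fin p → ℝ) : l1norm (v + w) ≤ l1norm v + l1norm w := by
  simp only [l1norm, ← Finset.sum_add_distrib]
  exact Finset.sum_le_sum fun j _ => abs_add_le _ _

lemma sub0_add_sub0_compl {p : ℕ} (S : Finset (Fin p)) (v : Fin p → ℝ) :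
    sub0 S v + sub0 Sᶜ v = v := by
  ext j
  by_cases hj : j ∈ S <;> simp [sub0, hj]

lemma l1norm_sub0_add_compl {p : ℕ} (S : Finset (Fin p)) (v : Fin p → ℝ) :
    l1norm (sub0 S v) + l1norm (sub0 Sᶜ v) = l1norm v := by
  simp only [l1norm, ← Finset.sum_add_distrib]
  refine Finset.sum_congr rfl fun j _ => ?_
  by_cases hj : j ∈ S <;> simp [sub0, hj]

/-- Hölder's inequality for the `ℓ_∞` and `ℓ₁` norms. -/
lemma dotProduct_le_lsup_mul_l1norm {p : ℕ} (w u : Fin p → ℝ) :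
    w ⬝ᵥ u ≤ lsup w * l1norm u := by
  rw [l1norm, Finset.mul_sum]
  refine Finset.sum_le_sum fun j _ => ?_
  have h : |w j| ≤ lsup w :=
    le_ciSup (f := fun j => |w j|) (Set.finite_range _).bddAbove j
  calc w j * u j ≤ |w j * u j| := le_abs_self _
    _ = |w j| * |u j| := abs_mul _ _
    _ ≤ lsup w * |u j| := by gcongr

lemma compatSq_mul_sq_le {n p : ℕ} (X : Matrix (Fin n) (Fin p) ℝ) {L : ℝ}
    (S : Finset (Fin p)) (u : Fin p → ℝ)
    (hu : l1norm (sub0 Sᶜ u) ≤ L * l1norm (sub0 S u)) :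
    compatSq X L S * l1norm (sub0 S u) ^ 2 ≤ S.card * normN (X.mulVec u) ^ 2 := by
  rcases (l1norm_nonneg (sub0 S u)).eq_or_lt with hx | hx
  · rw [← hx]
    simp only [ne_eq, OfNat.ofNat_ne_zero, not_false_eq_true, zero_pow, mul_zero]
    positivity
  set x := l1norm (sub0 S u) with hxdef
  set b : Fin p → ℝ := x⁻¹ • (sub0 S u - sub0 Sᶜ u) with hb
  have h1 : sub0 S b = x⁻¹ • sub0 S u := by
    ext j
    by_cases hj : j ∈ S <;> simp [hb, sub0, hj]
  have h2 : sub0 Sᶜ b = (-x⁻¹) • sub0 Sᶜ u := by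
    ext j
    by_cases hj : j ∈ S <;> simp [hb, sub0, hj]
  have h3 : X.mulVec (sub0 S b) - X.mulVec (sub0 Sᶜ b) = x⁻¹ • X.mulVec u := by
    rw [h1, h2, ← Matrix.mulVec_sub, neg_smul, sub_neg_eq_add, ← smul_add,
      sub0_add_sub0_compl, Matrix.mulVec_smul]
  have h4 : compatSq X L S ≤ S.card * normN (x⁻¹ • X.mulVec u) ^ 2 := by
    refine csInf_le ⟨0, ?_⟩ ⟨b, ?_, ?_, by rw [h3]⟩
    · rintro r ⟨_, _, _, rfl⟩
      positivity
    · rw [h1, l1norm_smul, abs_of_pos (inv_pos.mpr hx), ← hxdef, inv_mul_cancel₀ hx.ne']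
    · rw [h2, l1norm_smul, abs_neg, abs_of_pos (inv_pos.mpr hx), inv_mul_le_iff₀ hx]
      linarith
  have h5 : normN (x⁻¹ • X.mulVec u) ^ 2 * x ^ 2 = normN (X.mulVec u) ^ 2 := by
    rw [normN_smul_sq]
    field_simp
  calc compatSq X L S * x ^ 2 ≤ S.card * normN (x⁻¹ • X.mulVec u) ^ 2 * x ^ 2 := by gcongr
    _ = S.card * normN (X.mulVec u) ^ 2 := by rw [mul_assoc, h5]

/-- The variational inequality satisfied by a Lasso minimizer. -/
lemma lasso_variational {n p : ℕ} (X : Matrix (Fin n) (Fin p) ℝ) (Y : Fin n → ℝ)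
    {lam : ℝ} (hlam : 0 ≤ lam) (βhat : Fin p → ℝ)
    (hβhat : ∀ β : Fin p → ℝ,
      (normN (Y - X.mulVec βhat)) ^ 2 + 2 * lam * l1norm βhat ≤
        (normN (Y - X.mulVec β)) ^ 2 + 2 * lam * l1norm β)
    (β : Fin p → ℝ) :
    (Y - X.mulVec βhat) ⬝ᵥ X.mulVec (β - βhat) / n ≤ lam * (l1norm β - l1norm βhat) := by
  by_contra! hlt
  set c := (Y - X.mulVec βhat) ⬝ᵥ X.mulVec (β - βhat) / n with hc
  set a := c - lam * (l1norm β - l1norm βhat) with ha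
  set q := normN (X.mulVec (β - βhat)) ^ 2 with hq
  have hapos : 0 < a := sub_pos.mpr hlt
  have hq0 : 0 ≤ q := sq_nonneg _
  have key : ∀ t : ℝ, 0 < t → t ≤ 1 → 2 * a ≤ t * q := by
    intro t ht ht1
    have h := hβhat ((1 - t) • βhat + t • β)
    have hl : l1norm ((1 - t) • βhat + t • β) ≤ (1 - t) * l1norm βhat + t * l1norm β := by
      refine (l1norm_add_le _ _).trans_eq ?_
      rw [l1norm_smul, l1norm_smul, abs_of_pos ht, abs_of_nonneg (sub_nonneg.mpr ht1)]
    have hv : Y - X.mulVec ((1 - t) • βhat + t • β) =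
        (Y - X.mulVec βhat) - t • X.mulVec (β - βhat) := by
      rw [Matrix.mulVec_add, Matrix.mulVec_smul, Matrix.mulVec_smul, Matrix.mulVec_sub]
      module
    have hN : normN (Y - X.mulVec ((1 - t) • βhat + t • β)) ^ 2 =
        normN (Y - X.mulVec βhat) ^ 2 - 2 * t * c + t ^ 2 * q := by
      rw [hv, hc, hq, normN_sub_sq, normN_smul_sq, dotProduct_smul, smul_eq_mul]
      ring
    have hl' := mul_le_mul_of_nonneg_left hl hlam
    have : t * (2 * a) ≤ t * (t * q) := by
      rw [ha]
      nlinarith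
    exact le_of_mul_le_mul_left this ht
  have h := key (a / (a + q)) (by positivity) (by rw [div_le_one (by positivity)]; linarith)
  have h' : a / (a + q) * q ≤ a := by
    rw [div_mul_eq_mul_div, div_le_iff₀ (by positivity)]
    nlinarith
  linarith

/-- The reverse triangle inequality off the support `S` of `β`. -/
lemma l1norm_sub_le_of_support {p : ℕ} (S : Finset (Fin p)) (β b : Fin p → ℝ)
    (hS : ∀ j, j ∈ S ↔ β j ≠ 0) :
    l1norm β - l1norm b ≤ l1norm (sub0 S (b - β)) - l1norm (sub0 Sᶜ (b - β)) := by
  simp only [l1norm, ← Finset.sum_sub_distrib]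
  refine Finset.sum_le_sum fun j _ => ?_
  by_cases hj : j ∈ S
  · have := abs_sub_abs_le_abs_sub (β j) (b j)
    rw [abs_sub_comm] at this
    simpa [sub0, hj] using this
  · have h0 : β j = 0 := by
      by_contra h
      exact hj ((hS j).mpr h)
    simp [sub0, hj, h0]

theorem lasso_ell1_oracle
    {n p : ℕ} (X : Matrix (Fin n) (Fin p) ℝ) (Y : Fin n → ℝ)
    (β0 : Fin p → ℝ) (ε : Fin n → ℝ) (hε : ε = Y - X.mulVec β0)
    (lam lamε : ℝ) (hlam0 : 0 < lam)
    (hlamε : lamε ≥ lsup (Xᵀ.mulVec ε) / n)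
    (δ : ℝ) (hδ0 : 0 ≤ δ) (hδ1 : δ < 1)
    (hlam : lam > lamε)
    (L : ℝ) (hL : L = (lam + lamε + δ * (lam - lamε)) / ((1 - δ) * (lam - lamε)))
    (βhat : Fin p → ℝ)
    (hβhat : ∀ β : Fin p → ℝ,
      (normN (Y - X.mulVec βhat)) ^ 2 + 2 * lam * l1norm βhat ≤
        (normN (Y - X.mulVec β)) ^ 2 + 2 * lam * l1norm β)
    (β : Fin p → ℝ) (S : Finset (Fin p)) (hS : ∀ j, j ∈ S ↔ β j ≠ 0)
    (hφ : 0 < compatSq X L S) :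
    2 * δ * (lam - lamε) * l1norm (βhat - β0) + (normN (X.mulVec (βhat - β0))) ^ 2 ≤
      2 * δ * (lam - lamε) * l1norm (β - β0) + (normN (X.mulVec (β - β0))) ^ 2 +
        (lam + lamε + δ * (lam - lamε)) ^ 2 * S.card / compatSq X L S := by
  set u := βhat - β with hu
  set x := l1norm (sub0 S u) with hx
  set y := l1norm (sub0 Sᶜ u) with hy
  set φ := compatSq X L S with hφdef
  set A := X.mulVec u ⬝ᵥ X.mulVec (βhat - β0) / n with hA
  set K := lam + lamε + δ * (lam - lamε) with hK
  have hxy : x + y = l1norm u := l1norm_sub0_add_compl S u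
  have hd : 0 < lam - lamε := sub_pos.mpr hlam
  have hy0 : 0 ≤ y := l1norm_nonneg _
  have hpol : 2 * A = normN (X.mulVec (βhat - β0)) ^ 2 - normN (X.mulVec (β - β0)) ^ 2
      + normN (X.mulVec u) ^ 2 := by
    have hsplit : X.mulVec (β - β0) = X.mulVec (βhat - β0) - X.mulVec u := by
      rw [← Matrix.mulVec_sub, hu]
      congr 1
      abel
    rw [hsplit, hA, normN_sub_sq, dotProduct_comm (X.mulVec u)]
    ring
  have htri : l1norm (βhat - β0) ≤ l1norm u + l1norm (β - β0) := by
    simpa [hu] using l1norm_add_le u (β - β0)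
  have htri' := mul_le_mul_of_nonneg_left htri (mul_nonneg hδ0 hd.le)
  rcases le_total A (-(δ * (lam - lamε) * l1norm u)) with hcase | hcase
  · have : 0 ≤ K ^ 2 * S.card / φ := by positivity
    nlinarith [sq_nonneg (normN (X.mulVec u))]
  have hnoise : ε ⬝ᵥ X.mulVec u / n ≤ lamε * l1norm u := by
    have h := dotProduct_le_lsup_mul_l1norm (Xᵀ.mulVec ε) u
    rw [Matrix.mulVec_transpose, ← Matrix.dotProduct_mulVec, ← Matrix.mulVec_transpose] at h
    calc ε ⬝ᵥ X.mulVec u / n ≤ lsup (Xᵀ.mulVec ε) * l1norm u / n := by gcongr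
      _ = lsup (Xᵀ.mulVec ε) / n * l1norm u := by ring
      _ ≤ lamε * l1norm u := mul_le_mul_of_nonneg_right hlamε (l1norm_nonneg _)
  have hvar : A - ε ⬝ᵥ X.mulVec u / n ≤ lam * (l1norm β - l1norm βhat) := by
    refine le_of_eq_of_le ?_ (lasso_variational X Y hlam0.le βhat hβhat β)
    have h1 : Y - X.mulVec βhat = ε - X.mulVec (βhat - β0) := by
      rw [hε, Matrix.mulVec_sub]
      abel
    have h2 : X.mulVec (β - βhat) = -X.mulVec u := by
      rw [hu, ← Matrix.mulVec_neg, neg_sub]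
    rw [h1, h2, dotProduct_neg, sub_dotProduct, hA,
      dotProduct_comm (X.mulVec u) (X.mulVec (βhat - β0))]
    ring
  have hsupp := mul_le_mul_of_nonneg_left (l1norm_sub_le_of_support S β βhat hS) hlam0.le
  rw [← hu, ← hx, ← hy] at hsupp
  have hbasic : A + δ * (lam - lamε) * l1norm u + (1 - δ) * (lam - lamε) * y ≤ K * x := by
    rw [← hxy] at hnoise ⊢
    rw [hK]
    linarith
  have hcone : y ≤ L * x := by
    rw [hL, div_mul_eq_mul_div, le_div_iff₀ (mul_pos (sub_pos.mpr hδ1) hd)]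
    linarith
  have hcompat : φ * x ^ 2 ≤ S.card * normN (X.mulVec u) ^ 2 := compatSq_mul_sq_le X S u hcone
  have hyoung : 2 * (K * x) ≤ K ^ 2 * S.card / φ + normN (X.mulVec u) ^ 2 := by
    rcases S.card.eq_zero_or_pos with h0 | hpos
    · have hx2 : x = 0 := by
        rw [h0, Nat.cast_zero, zero_mul] at hcompat
        exact pow_eq_zero_iff two_ne_zero |>.mp
          (le_antisymm (nonpos_of_mul_nonpos_right hcompat hφ) (sq_nonneg x))
      rw [hx2, mul_zero, mul_zero]
      positivity
    · have hs : (0 : ℝ) < S.card := by exact_mod_cast hpos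
      have h1 : φ * x ^ 2 / S.card ≤ normN (X.mulVec u) ^ 2 := by
        rw [div_le_iff₀ hs]
        linarith
      have h2 : K ^ 2 * S.card / φ + φ * x ^ 2 / S.card - 2 * (K * x) =
          (K * S.card - φ * x) ^ 2 / (φ * S.card) := by
        field_simp
        ring
      have h3 : 0 ≤ (K * S.card - φ * x) ^ 2 / (φ * S.card) := by positivity
      linarith
  have hrest : 0 ≤ (1 - δ) * (lam - lamε) * y :=
    mul_nonneg (mul_nonneg (sub_nonneg.mpr hδ1.le) hd.le) hy0
  linarith
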